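/- arXiv:2008.05127 — 2 statements merged into one kernel-verified Lean document; each statement's English description precedes it below -/
import Mathlib

section
/- Let N ≥ 3 and let α be a real number with 0 ≤ 2α ≤ N − 3. Then for every u ∈ C_c^∞(ℍ^N∖{o}) one has ∫_{ℍ^N} (Δ_r u)²/r^{α−2} dv ≥ ((N−2−α)²(N−2+α)²/16) ∫_{ℍ^N} u²/r^{α+2} dv + ((N−2−α)(N−2+α)(N−1)/4) ∫_{ℍ^N} u²/r^α dv. -/
open MeasureTheory Real Set

noncomputable section

/-- The radial derivative `∇_r u = ∂u/∂r` of a function `u(r,σ)`. -/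
def radGrad (N : ℕ) (u : ℝ → EuclideanSpace ℝ (Fin N) → ℝ) :
    ℝ → EuclideanSpace ℝ (Fin N) → ℝ :=
  fun r σ => deriv (fun s => u s σ) r

/-- The radial Laplacian `Δ_r u = ∂²u/∂r² + (N-1) coth r · ∂u/∂r`. -/
def radLap (N : ℕ) (u : ℝ → EuclideanSpace ℝ (Fin N) → ℝ) :
    ℝ → EuclideanSpace ℝ (Fin N) → ℝ :=
  fun r σ => deriv (fun s => deriv (fun t => u t σ) s) r
    + ((N : ℝ) - 1) * (Real.cosh r / Real.sinh r) * deriv (fun s => u s σ) r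

/-- The higher order radial derivative `∇_r^k u`: `Δ_r^{k/2} u` for even `k`,
`∂_r (Δ_r^{(k-1)/2} u)` for odd `k`. -/
def radPow (N k : ℕ) (u : ℝ → EuclideanSpace ℝ (Fin N) → ℝ) :
    ℝ → EuclideanSpace ℝ (Fin N) → ℝ :=
  if Even k then (radLap N)^[k / 2] u else radGrad N ((radLap N)^[k / 2] u)

/-- The integral over the hyperbolic space `ℍ^N` in polar coordinates:
`∫_{S^{N-1}} ∫_0^∞ F(r,σ) (sinh r)^{N-1} dr dσ`, where `dσ` is the standard
surface measure (the `(N-1)`-dimensional Hausdorff measure) on the unit sphere. -/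
def hypInt (N : ℕ) (F : ℝ → EuclideanSpace ℝ (Fin N) → ℝ) : ℝ :=
  ∫ σ in Metric.sphere (0 : EuclideanSpace ℝ (Fin N)) 1,
    (∫ r in Ioi (0 : ℝ), F r σ * Real.sinh r ^ (N - 1)) ∂μH[(N : ℝ) - 1]

/-- `u ∈ C_c^∞(ℍ^N)`: `u(r,σ)` smooth (including at the pole `r = 0`) and
vanishing for all `r` larger than some `R`. -/
def IsCc (N : ℕ) (u : ℝ → EuclideanSpace ℝ (Fin N) → ℝ) : Prop :=
  ContDiff ℝ (⊤ : ℕ∞) (Function.uncurry u) ∧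
  ∃ R : ℝ, ∀ r : ℝ, R < r → ∀ σ ∈ Metric.sphere (0 : EuclideanSpace ℝ (Fin N)) 1, u r σ = 0

/-- `u ∈ C_c^∞(ℍ^N \ {o})`: `u(r,σ)` smooth with support contained in
`[a,b] × S^{N-1}` for some `0 < a ≤ b`. -/
def IsCcAway (N : ℕ) (u : ℝ → EuclideanSpace ℝ (Fin N) → ℝ) : Prop :=
  ContDiff ℝ (⊤ : ℕ∞) (Function.uncurry u) ∧
  ∃ a b : ℝ, 0 < a ∧ a ≤ b ∧
    ∀ r : ℝ, r ∉ Icc a b → ∀ σ ∈ Metric.sphere (0 : EuclideanSpace ℝ (Fin N)) 1, u r σ = 0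

theorem sinh_le_mul_cosh {r : ℝ} (hr : 0 ≤ r) : sinh r ≤ r * cosh r := by
  have h : MonotoneOn (fun x : ℝ => x * cosh x - sinh x) (Ici 0) := by
    refine monotoneOn_of_hasDerivWithinAt_nonneg (f' := fun x => x * sinh x) (convex_Ici 0)
      (by fun_prop) (fun x _ => ?_) (fun x hx => ?_)
    · refine (((hasDerivAt_id x).mul (hasDerivAt_cosh x)).sub
        (hasDerivAt_sinh x)).hasDerivWithinAt.congr_deriv ?_
      simp
    · rw [interior_Ici] at hx
      exact mul_nonneg hx.le (sinh_nonneg_iff.2 hx.le)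
  simpa using h (mem_Ici.2 le_rfl) (mem_Ici.2 hr) hr

/-- The derivative of the boundary term in the radial Rellich inequality. -/
theorem hasDerivAt_rellichBoundary {f : ℝ → ℝ} {p q r : ℝ} (n : ℕ) (α : ℝ) (hr : 0 < r)
    (hf : HasDerivAt f p r) (hf' : HasDerivAt (deriv f) q r) :
    HasDerivAt (fun s => -(f s * deriv f s + (n / 2 * (cosh s / sinh s) - s⁻¹ / 2) * f s ^ 2)
        * s ^ (-α) * sinh s ^ n)
      (-(p ^ 2 + f r * q + (n / 2 * (1 - (cosh r / sinh r) ^ 2) + (r⁻¹) ^ 2 / 2) * f r ^ 2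
          + (n * (cosh r / sinh r) - r⁻¹) * f r * p
          + (f r * p + (n / 2 * (cosh r / sinh r) - r⁻¹ / 2) * f r ^ 2)
            * (n * (cosh r / sinh r) - α * r⁻¹)) * r ^ (-α) * sinh r ^ n) r := by
  have hS : 0 < sinh r := sinh_pos_iff.2 hr
  have h1 := (hf.mul hf').add ((((((hasDerivAt_cosh r).div (hasDerivAt_sinh r) hS.ne').const_mul
    ((n : ℝ) / 2))).sub ((hasDerivAt_inv hr.ne').div_const 2)).mul (hf.pow 2))
  have h2 := (h1.neg.mul (Real.hasDerivAt_rpow_const (p := -α) (Or.inl hr.ne'))).mul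
    ((hasDerivAt_sinh r).pow n)
  refine h2.congr_deriv ?_
  simp only [Pi.mul_apply, Pi.add_apply, Pi.sub_apply, Pi.div_apply, Pi.pow_apply, Pi.neg_apply]
  rw [hf.deriv, Real.rpow_sub_one hr.ne']
  rcases n with _ | n
  · simp
    field_simp
    ring
  · simp only [Nat.add_sub_cancel, pow_succ (sinh r) n]
    push_cast
    field_simp
    ring

theorem rellich_pointwise {n : ℕ} (hn : 2 ≤ n) {α c r y p q : ℝ} (hc : 0 ≤ c)
    (hcα : c = (((n : ℝ) - 1) ^ 2 - α ^ 2) / 4) (hr : 0 < r) :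
    2 * c * (-(p ^ 2 + y * q + (n / 2 * (1 - (cosh r / sinh r) ^ 2) + (r⁻¹) ^ 2 / 2) * y ^ 2
          + (n * (cosh r / sinh r) - r⁻¹) * y * p
          + (y * p + (n / 2 * (cosh r / sinh r) - r⁻¹ / 2) * y ^ 2)
            * (n * (cosh r / sinh r) - α * r⁻¹)) * r ^ (-α) * sinh r ^ n)
      ≤ (q + n * (cosh r / sinh r) * p) ^ 2 / r ^ (α - 2) * sinh r ^ n
        - (c ^ 2 * (y ^ 2 / r ^ (α + 2) * sinh r ^ n) + c * n * (y ^ 2 / r ^ α * sinh r ^ n)) := by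
  have hS : 0 < sinh r := sinh_pos_iff.2 hr
  have hP : 0 < r ^ α := rpow_pos_of_pos hr α
  have hkt : r⁻¹ ≤ cosh r / sinh r := by
    rw [inv_eq_one_div, div_le_div_iff₀ hr hS]
    linarith [sinh_le_mul_cosh hr.le]
  rw [rpow_neg hr.le, rpow_sub hr, rpow_add hr, rpow_two]
  set k := cosh r / sinh r
  set t := r⁻¹ with ht
  have htpos : 0 < t := inv_pos.2 hr
  have hrt : r = t⁻¹ := by simp [ht]
  have hn' : (2 : ℝ) ≤ n := by exact_mod_cast hn
  have hsq : 0 ≤ k ^ 2 - t ^ 2 := by nlinarith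
  have key : 0 ≤ ((q + n * k * p) / t + c * y * t) ^ 2
      + 2 * c * ((p + (n / 2 * k - (1 + α) / 2 * t) * y) ^ 2
        + n * (n - 2) / 4 * (k ^ 2 - t ^ 2) * y ^ 2) := by
    have : 0 ≤ (n : ℝ) * (n - 2) := mul_nonneg (by linarith) (by linarith)
    positivity
  have hmul := mul_nonneg key (mul_nonneg (inv_nonneg.2 hP.le) (pow_nonneg hS.le n))
  rw [← sub_nonneg]
  refine hmul.trans_eq ?_
  generalize (r ^ α) = P at *
  subst hcα
  rw [hrt]
  field_simp
  ring

/-- `u(r, σ)` is supported, over the unit sphere, in `a ≤ r ≤ b`. -/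
def SupportedIn (N : ℕ) (a b : ℝ) (u : ℝ → EuclideanSpace ℝ (Fin N) → ℝ) : Prop :=
  ∀ r : ℝ, r ∉ Icc a b → ∀ σ ∈ Metric.sphere (0 : EuclideanSpace ℝ (Fin N)) 1, u r σ = 0

theorem SupportedIn.radGrad {N : ℕ} {a b : ℝ} {u : ℝ → EuclideanSpace ℝ (Fin N) → ℝ}
    (hu : SupportedIn N a b u) : SupportedIn N a b (radGrad N u) := by
  intro r hr σ hσ
  have h : (fun s => u s σ) =ᶠ[nhds r] fun _ => 0 := by
    filter_upwards [isClosed_Icc.isOpen_compl.mem_nhds hr] with s hs using hu s hs σ hσ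
  exact h.deriv_eq.trans (deriv_const r 0)

theorem contDiff_radGrad {N : ℕ} {u : ℝ → EuclideanSpace ℝ (Fin N) → ℝ}
    (hu : ContDiff ℝ (⊤ : ℕ∞) (Function.uncurry u)) :
    ContDiff ℝ (⊤ : ℕ∞) (Function.uncurry (radGrad N u)) := by
  have h : ContDiff ℝ (⊤ : ℕ∞) (Function.uncurry fun (x : ℝ × EuclideanSpace ℝ (Fin N)) s =>
      u s x.2) :=
    hu.comp (f := fun z : (ℝ × EuclideanSpace ℝ (Fin N)) × ℝ => (z.2, z.1.2)) (by fun_prop)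
  have h' := h.fderiv_apply (n := (⊤ : ℕ∞)) (g := Prod.fst) (k := fun _ => (1 : ℝ)) contDiff_fst
    contDiff_const (by norm_cast)
  exact h'

theorem radLap_eq {N : ℕ} (u : ℝ → EuclideanSpace ℝ (Fin N) → ℝ) (r : ℝ)
    (σ : EuclideanSpace ℝ (Fin N)) :
    radLap N u r σ = radGrad N (radGrad N u) r σ
      + ((N : ℝ) - 1) * (cosh r / sinh r) * radGrad N u r σ := rfl

section RadialIntegral

variable {N : ℕ} {a b : ℝ} {F : ℝ → EuclideanSpace ℝ (Fin N) → ℝ}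

theorem SupportedIn.continuousOn_mul_sinh_pow (ha : 0 < a) (hF : SupportedIn N a b F)
    (hc : ContinuousOn (Function.uncurry F) (Ioi 0 ×ˢ univ)) :
    ContinuousOn (Function.uncurry fun σ r => F r σ * sinh r ^ (N - 1))
      (Metric.sphere (0 : EuclideanSpace ℝ (Fin N)) 1 ×ˢ univ) := by
  rintro ⟨σ, r⟩ ⟨hσ, -⟩
  rcases lt_or_ge r a with hra | hra
  · have h0 : ∀ p ∈ Metric.sphere (0 : EuclideanSpace ℝ (Fin N)) 1 ×ˢ Iio a,
        F p.2 p.1 * sinh p.2 ^ (N - 1) = 0 := fun p hp => by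
      rw [hF p.2 (fun h => not_lt.2 h.1 hp.2) p.1 hp.1, zero_mul]
    refine (continuousWithinAt_const (b := (0 : ℝ))).congr_of_eventuallyEq ?_ (h0 _ ⟨hσ, hra⟩)
    have hmem : (univ : Set (EuclideanSpace ℝ (Fin N))) ×ˢ Iio a ∈ nhds (σ, r) :=
      (isOpen_univ.prod isOpen_Iio).mem_nhds ⟨trivial, hra⟩
    filter_upwards [self_mem_nhdsWithin, mem_nhdsWithin_of_mem_nhds hmem] with p hp hp'
    exact h0 p ⟨hp.1, hp'.2⟩
  · have hr : 0 < r := ha.trans_le hra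
    have hFc : ContinuousAt (Function.uncurry F) (r, σ) :=
      hc.continuousAt ((isOpen_Ioi.prod isOpen_univ).mem_nhds ⟨hr, trivial⟩)
    have hsw : ContinuousAt (fun p : EuclideanSpace ℝ (Fin N) × ℝ => F p.2 p.1) (σ, r) :=
      ContinuousAt.comp (f := Prod.swap) (x := (σ, r)) hFc continuous_swap.continuousAt
    exact (hsw.mul (by fun_prop)).continuousWithinAt

theorem SupportedIn.continuousOn_integral (ha : 0 < a) (hF : SupportedIn N a b F)
    (hc : ContinuousOn (Function.uncurry F) (Ioi 0 ×ˢ univ)) :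
    ContinuousOn (fun σ => ∫ r in Ioi (0 : ℝ), F r σ * sinh r ^ (N - 1))
      (Metric.sphere (0 : EuclideanSpace ℝ (Fin N)) 1) :=
  continuousOn_integral_of_compact_support (isCompact_Icc (a := a) (b := b))
    (hF.continuousOn_mul_sinh_pow ha hc) fun σ r hσ hr => by rw [hF r hr σ hσ, zero_mul]

theorem SupportedIn.integral_eq_intervalIntegral (ha : 0 < a) (hab : a ≤ b)
    (hF : SupportedIn N a b F) {σ : EuclideanSpace ℝ (Fin N)}
    (hσ : σ ∈ Metric.sphere (0 : EuclideanSpace ℝ (Fin N)) 1) :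
    ∫ r in Ioi (0 : ℝ), F r σ * sinh r ^ (N - 1)
      = ∫ r in (a / 2)..(b + 1), F r σ * sinh r ^ (N - 1) := by
  rw [intervalIntegral.integral_of_le (by linarith)]
  refine setIntegral_eq_of_subset_of_forall_sdiff_eq_zero measurableSet_Ioi
    (fun r hr => (half_pos ha).trans hr.1) fun r hr => ?_
  rw [hF r (fun h => hr.2 ⟨by linarith [h.1], by linarith [h.2]⟩) σ hσ, zero_mul]

theorem SupportedIn.intervalIntegrable (ha : 0 < a) (hab : a ≤ b)
    (hc : ContinuousOn (Function.uncurry F) (Ioi 0 ×ˢ univ)) (σ : EuclideanSpace ℝ (Fin N)) :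
    IntervalIntegrable (fun r => F r σ * sinh r ^ (N - 1)) volume (a / 2) (b + 1) := by
  refine ContinuousOn.intervalIntegrable_of_Icc (by linarith) (ContinuousOn.mul ?_ (by fun_prop))
  exact hc.comp (f := fun r : ℝ => (r, σ)) (by fun_prop)
    fun r hr => ⟨(half_pos ha).trans_le hr.1, trivial⟩

end RadialIntegral

theorem rellich_on_ray {n N : ℕ} (hN : N = n + 1) (hn : 2 ≤ n) {α c a b : ℝ} (hc : 0 ≤ c)
    (hcα : c = (((n : ℝ) - 1) ^ 2 - α ^ 2) / 4) (ha : 0 < a) (hab : a ≤ b)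
    {u : ℝ → EuclideanSpace ℝ (Fin N) → ℝ} (hu : ContDiff ℝ (⊤ : ℕ∞) (Function.uncurry u))
    (hs : SupportedIn N a b u) {σ : EuclideanSpace ℝ (Fin N)}
    (hσ : σ ∈ Metric.sphere (0 : EuclideanSpace ℝ (Fin N)) 1)
    {φ : ℝ → ℝ} (hφ : φ = fun r => radLap N u r σ ^ 2 / r ^ (α - 2) * sinh r ^ (N - 1)
        - (c ^ 2 * (u r σ ^ 2 / r ^ (α + 2) * sinh r ^ (N - 1))
          + c * n * (u r σ ^ 2 / r ^ α * sinh r ^ (N - 1))))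
    (hφi : IntervalIntegrable φ volume (a / 2) (b + 1)) :
    0 ≤ ∫ r in (a / 2)..(b + 1), φ r := by
  subst hN
  have hray {v : ℝ → EuclideanSpace ℝ (Fin (n + 1)) → ℝ}
      (hv : ContDiff ℝ (⊤ : ℕ∞) (Function.uncurry v)) (r : ℝ) :
      HasDerivAt (fun s => v s σ) (radGrad (n + 1) v r σ) r := by
    have : ContDiff ℝ (⊤ : ℕ∞) fun s => v s σ := hv.comp (f := fun s : ℝ => (s, σ)) (by fun_prop)
    exact (this.differentiable (by simp) r).hasDerivAt
  have hG (r : ℝ) (hr : 0 < r) := (hasDerivAt_rellichBoundary n α hr (hray hu r)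
    (hray (contDiff_radGrad hu) r)).const_mul (2 * c)
  have hle : a / 2 ≤ b + 1 := by linarith
  have hpos {r : ℝ} (hr : a / 2 ≤ r) : 0 < r := by linarith
  have h := intervalIntegral.sub_le_integral_of_hasDeriv_right_of_le hle
    (fun r hr => (hG r (hpos hr.1)).continuousAt.continuousWithinAt)
    (fun r hr => (hG r (hpos hr.1.le)).hasDerivWithinAt)
    ((intervalIntegrable_iff_integrableOn_Icc_of_le hle).1 hφi)
    (fun r hr => by
      have := rellich_pointwise hn hc hcα (hpos hr.1.le) (y := u r σ)
        (p := radGrad (n + 1) u r σ) (q := radGrad (n + 1) (radGrad (n + 1) u) r σ)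
      rw [hφ]
      simpa [radLap_eq] using this)
  have h1 : u (a / 2) σ = 0 := hs _ (fun h => by linarith [h.1]) σ hσ
  have h2 : u (b + 1) σ = 0 := hs _ (fun h => by linarith [h.2]) σ hσ
  simpa [h1, h2] using h

theorem hausdorffMeasure_sphere_lt_top (n : ℕ) :
    μH[(n : ℝ)] (Metric.sphere (0 : EuclideanSpace ℝ (Fin (n + 1))) 1) < ⊤ := by
  let g (i : Fin (n + 1)) (s : ℝ) (y : Fin n → ℝ) : EuclideanSpace ℝ (Fin (n + 1)) :=
    WithLp.toLp 2 (i.insertNth s y)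
  let f (i : Fin (n + 1)) (s : ℝ) (y : Fin n → ℝ) : EuclideanSpace ℝ (Fin (n + 1)) :=
    ‖g i s y‖⁻¹ • g i s y
  have hg (i : Fin (n + 1)) (s : ℝ) : ContDiff ℝ 1 (g i s) := by
    refine (contDiff_euclidean).2 fun j => ?_
    rcases Fin.eq_self_or_eq_succAbove i j with rfl | ⟨k, rfl⟩
    · simpa [g] using contDiff_const
    · simpa [g] using contDiff_apply ℝ ℝ k
  have hg0 (i : Fin (n + 1)) {s : ℝ} (hs : s ≠ 0) (y : Fin n → ℝ) : g i s y ≠ 0 := fun h => by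
    have := congrArg (fun x => x i) h
    simp [g, hs] at this
  have hf (i : Fin (n + 1)) {s : ℝ} (hs : s ≠ 0) : ContDiff ℝ 1 (f i s) :=
    (((hg i s).norm ℝ (hg0 i hs)).inv fun y => norm_ne_zero_iff.2 (hg0 i hs y)).smul (hg i s)
  have hface (i : Fin (n + 1)) {s : ℝ} (hs : s ≠ 0) :
      μH[(n : ℝ)] (f i s '' Icc (-1) 1) < ⊤ := by
    obtain ⟨K, hK⟩ :=
      (hf i hs).locallyLipschitz.locallyLipschitzOn.exists_lipschitzOnWith_of_compact
        (isCompact_Icc (a := (-1 : Fin n → ℝ)) (b := 1))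
    refine (hK.hausdorffMeasure_image_le n.cast_nonneg).trans_lt (ENNReal.mul_lt_top ?_ ?_)
    · exact ENNReal.rpow_lt_top_of_nonneg n.cast_nonneg ENNReal.coe_ne_top
    · have := hausdorffMeasure_pi_real (ι := Fin n)
      rw [Fintype.card_fin] at this
      rw [this]
      exact isCompact_Icc.measure_lt_top
  have hcover : Metric.sphere (0 : EuclideanSpace ℝ (Fin (n + 1))) 1
      ⊆ ⋃ i : Fin (n + 1), (f i 1 '' Icc (-1) 1 ∪ f i (-1) '' Icc (-1) 1) := by
    intro σ hσ
    have hσ1 : ‖σ‖ = 1 := by simpa using hσ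
    obtain ⟨i, hi⟩ := Finite.exists_max fun i => |σ i|
    have hσi : 0 < |σ i| := by
      rw [abs_pos]
      intro h0
      have : σ = 0 := by
        ext j
        simpa [h0] using hi j
      simp [this] at hσ1
    have hgσ : g i (σ i / |σ i|) (fun k => σ (i.succAbove k) / |σ i|) = |σ i|⁻¹ • σ := by
      ext j
      rcases Fin.eq_self_or_eq_succAbove i j with rfl | ⟨k, rfl⟩ <;>
        simp [g, div_eq_inv_mul]
    have hfσ : f i (σ i / |σ i|) (fun k => σ (i.succAbove k) / |σ i|) = σ := by
      simp only [f]
      rw [hgσ, norm_smul, hσ1, norm_inv, norm_eq_abs, abs_abs, mul_one, inv_inv, smul_smul,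
        mul_inv_cancel₀ hσi.ne', one_smul]
    have hmem : (fun k => σ (i.succAbove k) / |σ i|) ∈ Icc (-1 : Fin n → ℝ) 1 := by
      refine ⟨fun k => ?_, fun k => ?_⟩
      · rw [Pi.neg_apply, Pi.one_apply, le_div_iff₀ hσi]
        linarith [neg_abs_le (σ (i.succAbove k)), hi (i.succAbove k)]
      · rw [Pi.one_apply, div_le_one hσi]
        exact (le_abs_self _).trans (hi _)
    refine mem_iUnion.2 ⟨i, ?_⟩
    rcases lt_or_gt_of_ne (abs_pos.1 hσi) with h | h
    · right
      refine ⟨_, hmem, ?_⟩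
      rwa [abs_of_neg h, div_neg, div_self h.ne, ← abs_of_neg h] at hfσ
    · left
      refine ⟨_, hmem, ?_⟩
      nth_rw 1 [abs_of_pos h] at hfσ
      rwa [div_self h.ne'] at hfσ
  refine (measure_mono hcover).trans_lt ((measure_iUnion_le _).trans_lt ?_)
  rw [tsum_fintype]
  exact ENNReal.sum_lt_top.2 fun i _ => (measure_union_le _ _).trans_lt
    (ENNReal.add_lt_top.2 ⟨hface i one_ne_zero, hface i (by norm_num)⟩)

theorem SupportedIn.integrableOn_integral {N : ℕ} (hN : 1 ≤ N) {a b : ℝ}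
    {F : ℝ → EuclideanSpace ℝ (Fin N) → ℝ} (ha : 0 < a) (hF : SupportedIn N a b F)
    (hc : ContinuousOn (Function.uncurry F) (Ioi 0 ×ˢ univ)) :
    IntegrableOn (fun σ => ∫ r in Ioi (0 : ℝ), F r σ * sinh r ^ (N - 1))
      (Metric.sphere (0 : EuclideanSpace ℝ (Fin N)) 1) μH[(N : ℝ) - 1] := by
  obtain ⟨n, rfl⟩ := Nat.exists_eq_add_of_le' hN
  have hcont := hF.continuousOn_integral ha hc
  obtain ⟨C, hC⟩ := (isCompact_sphere _ _).exists_bound_of_continuousOn hcont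
  refine IntegrableOn.of_bound ?_ (hcont.aestronglyMeasurable Metric.isClosed_sphere.measurableSet)
    C ((ae_restrict_iff' Metric.isClosed_sphere.measurableSet).2 (.of_forall hC))
  simpa using hausdorffMeasure_sphere_lt_top n

/-- Weighted Rellich inequality with radial Laplacian on `ℍ^N` for `0 ≤ 2α ≤ N-3`. -/
theorem weighted_radial_rellich (N : ℕ) (hN : 3 ≤ N) (α : ℝ)
    (hα0 : 0 ≤ 2 * α) (hα : 2 * α ≤ (N : ℝ) - 3)
    (u : ℝ → EuclideanSpace ℝ (Fin N) → ℝ) (hu : IsCcAway N u) :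
    hypInt N (fun r σ => (radLap N u r σ) ^ 2 / r ^ (α - 2)) ≥
      (((N : ℝ) - 2 - α) ^ 2 * ((N : ℝ) - 2 + α) ^ 2 / 16) *
          hypInt N (fun r σ => (u r σ) ^ 2 / r ^ (α + 2))
      + (((N : ℝ) - 2 - α) * ((N : ℝ) - 2 + α) * ((N : ℝ) - 1) / 4) *
          hypInt N (fun r σ => (u r σ) ^ 2 / r ^ α) := by
  obtain ⟨hsm, a, b, ha, hab, hs⟩ := hu
  replace hs : SupportedIn N a b u := hs
  obtain ⟨n, rfl⟩ := Nat.exists_eq_add_of_le' (show 1 ≤ N by lia)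
  have hn : 2 ≤ n := by lia
  have hn' : (2 : ℝ) ≤ n := by exact_mod_cast hn
  push_cast at hα
  obtain ⟨c, hcα⟩ : ∃ c : ℝ, c = (((n : ℝ) - 1) ^ 2 - α ^ 2) / 4 := ⟨_, rfl⟩
  have hc : 0 ≤ c := by rw [hcα]; nlinarith
  have hpow (β : ℝ) : ContinuousOn (fun p : ℝ × EuclideanSpace ℝ (Fin (n + 1)) => p.1 ^ β)
      (Ioi 0 ×ˢ univ) := fun p hp =>
    (continuousAt_fst.rpow_const (Or.inl (ne_of_gt hp.1))).continuousWithinAt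
  have hcontu (β : ℝ) : ContinuousOn (Function.uncurry fun r σ => u r σ ^ 2 / r ^ β)
      (Ioi 0 ×ˢ univ) :=
    (hsm.continuous.pow 2).continuousOn.div (hpow β) fun p hp => (rpow_pos_of_pos hp.1 β).ne'
  have hsupu (β : ℝ) : SupportedIn (n + 1) a b fun r σ => u r σ ^ 2 / r ^ β := fun r hr σ hσ => by
    simp [hs r hr σ hσ]
  have hgrad := contDiff_radGrad hsm
  have hlap : ContinuousOn (Function.uncurry (radLap (n + 1) u)) (Ioi 0 ×ˢ univ) :=
    (contDiff_radGrad hgrad).continuous.continuousOn.add <| (continuousOn_const.mul <|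
      ContinuousOn.div (by fun_prop) (by fun_prop) fun p hp => (sinh_pos_iff.2 hp.1).ne').mul
        hgrad.continuous.continuousOn
  have hcontL : ContinuousOn (Function.uncurry fun r σ => radLap (n + 1) u r σ ^ 2 / r ^ (α - 2))
      (Ioi 0 ×ˢ univ) :=
    (hlap.pow 2).div (hpow _) fun p hp => (rpow_pos_of_pos hp.1 _).ne'
  have hsupL : SupportedIn (n + 1) a b fun r σ => radLap (n + 1) u r σ ^ 2 / r ^ (α - 2) :=
    fun r hr σ hσ => by
      simp [radLap_eq, hs.radGrad r hr σ hσ, hs.radGrad.radGrad r hr σ hσ]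
  have hc1 : (((n + 1 : ℕ) : ℝ) - 2 - α) ^ 2 * (((n + 1 : ℕ) : ℝ) - 2 + α) ^ 2 / 16 = c ^ 2 := by
    rw [hcα]; push_cast; ring
  have hc2 : (((n + 1 : ℕ) : ℝ) - 2 - α) * (((n + 1 : ℕ) : ℝ) - 2 + α) * (((n + 1 : ℕ) : ℝ) - 1) / 4
      = c * n := by
    rw [hcα]; push_cast; ring
  rw [hc1, hc2, ge_iff_le]
  have hI1 := (hsupu (α + 2)).integrableOn_integral (by lia) ha (hcontu _)
  have hI2 := (hsupu α).integrableOn_integral (by lia) ha (hcontu _)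
  unfold hypInt
  rw [← integral_const_mul, ← integral_const_mul,
    ← integral_add (hI1.const_mul _) (hI2.const_mul _)]
  refine setIntegral_mono_on ((hI1.const_mul _).add (hI2.const_mul _))
    (hsupL.integrableOn_integral (by lia) ha hcontL) Metric.isClosed_sphere.measurableSet
    fun σ hσ => ?_
  have hi1 := SupportedIn.intervalIntegrable ha hab (hcontu (α + 2)) σ
  have hi2 := SupportedIn.intervalIntegrable ha hab (hcontu α) σ
  have hiL := SupportedIn.intervalIntegrable ha hab hcontL σ
  have hrhs := (hi1.const_mul (c ^ 2)).add (hi2.const_mul (c * n))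
  have key := rellich_on_ray rfl hn hc hcα ha hab hsm hs hσ rfl (hiL.sub hrhs)
  rw [intervalIntegral.integral_sub hiL hrhs,
    intervalIntegral.integral_add (hi1.const_mul _) (hi2.const_mul _),
    intervalIntegral.integral_const_mul, intervalIntegral.integral_const_mul] at key
  rw [(hsupu (α + 2)).integral_eq_intervalIntegral ha hab hσ,
    (hsupu α).integral_eq_intervalIntegral ha hab hσ,
    hsupL.integral_eq_intervalIntegral ha hab hσ]
  exact sub_nonneg.1 key
end
end

section
/- Let N ≥ 3. Then for every u ∈ C_c^∞(ℍ^N∖{o}) one has ∫_{ℍ^N} r^{2−N} |∇_r u|² dv ≥ ((N−1)/4) ∫_{ℍ^N} r^{2−N} u² dv; equivalently, the infimum μ_r(ℍ^N) of the ratio ∫_{ℍ^N} r^{2−N} |∇_r u|² dv / ∫_{ℍ^N} r^{2−N} u² dv over nonzero u ∈ C_c^∞(ℍ^N∖{o}) satisfies μ_r(ℍ^N) ≥ (N−1)/4. -/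
open MeasureTheory Real Set

noncomputable section

/-- The `d`-dimensional Hausdorff measure of the unit sphere of a `(d+1)`-dimensional Euclidean
space is finite. -/
theorem hausdorffMeasure_sphere_lt_top_s7 {E : Type*} [NormedAddCommGroup E] [InnerProductSpace ℝ E]
    [MeasurableSpace E] [BorelSpace E] {d : ℕ} [Fact (Module.finrank ℝ E = d + 1)] :
    μH[(d : ℝ)] (Metric.sphere (0 : E) 1) < ⊤ := by
  have : FiniteDimensional ℝ E := .of_fact_finrank_eq_succ d
  refine (isCompact_sphere (0 : E) 1).measure_lt_top_of_nhdsWithin fun σ hσ => ?_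
  have hσ' : ‖σ‖ = 1 := by simpa using hσ
  have hv : ‖-σ‖ = 1 := by simpa using hσ'
  have hv0 : -σ ≠ 0 := by rintro h; simp [h] at hv
  let W := (Submodule.span ℝ {-σ})ᗮ
  have hW : Module.finrank ℝ W = d := Submodule.finrank_orthogonal_span_singleton hv0
  let φ : W → E := fun w => (stereoInvFun hv w : E)
  have hφ : ContDiff ℝ 1 φ := contDiff_stereoInvFunAux.comp W.subtypeL.contDiff
  have h1 : innerSL ℝ (-σ) σ ≠ 1 := by
    simp [hσ']; norm_num
  have h0 : stereoToFun (-σ) σ = 0 := by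
    have : W.orthogonalProjectionOnto σ = 0 := by
      rw [Submodule.orthogonalProjectionOnto_eq_zero_iff, Submodule.orthogonal_orthogonal]
      exact Submodule.mem_span_singleton.2 ⟨-1, by simp⟩
    simp only [stereoToFun_apply]
    rw [this, smul_zero]
  obtain ⟨K, t, ht, hK⟩ := (hφ.contDiffAt (x := (0 : W))).exists_lipschitzOnWith
  have hopen : IsOpen {x : E | innerSL ℝ (-σ) x ≠ 1} :=
    isOpen_ne_fun (innerSL ℝ (-σ)).continuous continuous_const
  have hcont : ContinuousAt (stereoToFun (-σ)) σ :=
    continuousOn_stereoToFun.continuousAt (hopen.mem_nhds h1)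
  have hpre := hcont.preimage_mem_nhds (t := t ∩ Metric.ball 0 1) (by
    rw [h0]; exact Filter.inter_mem ht (Metric.ball_mem_nhds _ one_pos))
  refine ⟨_, inter_mem_nhdsWithin _ (Filter.inter_mem hpre (hopen.mem_nhds h1)), ?_⟩
  refine (measure_mono (t := φ '' (t ∩ Metric.ball 0 1)) ?_).trans_lt
    (((hK.mono inter_subset_left).hausdorffMeasure_image_le d.cast_nonneg).trans_lt
      (ENNReal.mul_lt_top (ENNReal.rpow_lt_top_of_nonneg d.cast_nonneg ENNReal.coe_ne_top) ?_))
  · rintro x ⟨hxs, hxt, hx1⟩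
    refine ⟨_, hxt, ?_⟩
    have hne : x ≠ -σ := by
      rintro rfl
      exact hx1 (by simp [hσ'])
    exact congrArg Subtype.val (stereo_left_inv hv (x := ⟨x, hxs⟩) hne)
  · rw [← hW]
    exact (measure_mono inter_subset_right).trans_lt measure_ball_lt_top

/-- A relatively open subset of the unit sphere of a `(d+1)`-dimensional Euclidean space that is
nonempty has positive `d`-dimensional Hausdorff measure. -/
theorem hausdorffMeasure_inter_sphere_pos {E : Type*} [NormedAddCommGroup E]
    [InnerProductSpace ℝ E] [MeasurableSpace E] [BorelSpace E] {d : ℕ}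
    [Fact (Module.finrank ℝ E = d + 1)] {U : Set E} {σ : E} (hU : U ∈ nhds σ)
    (hσ : σ ∈ Metric.sphere (0 : E) 1) : 0 < μH[(d : ℝ)] (U ∩ Metric.sphere (0 : E) 1) := by
  have : FiniteDimensional ℝ E := .of_fact_finrank_eq_succ d
  have hσ' : ‖σ‖ = 1 := by simpa using hσ
  have hv : ‖-σ‖ = 1 := by simpa using hσ'
  have hv0 : -σ ≠ 0 := by rintro h; simp [h] at hv
  let W := (Submodule.span ℝ {-σ})ᗮ
  have hW : Module.finrank ℝ W = d := Submodule.finrank_orthogonal_span_singleton hv0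
  let φ : W → E := fun w => (stereoInvFun hv w : E)
  have hφ : Continuous φ := continuous_subtype_val.comp (continuous_stereoInvFun hv)
  have hφ0 : φ 0 = σ := by
    simp only [φ, stereoInvFun_apply]
    norm_num [smul_smul]
  have h1 : innerSL ℝ (-σ) σ ≠ 1 := by
    simp [hσ']; norm_num
  have hopen : IsOpen {x : E | innerSL ℝ (-σ) x ≠ 1} :=
    isOpen_ne_fun (innerSL ℝ (-σ)).continuous continuous_const
  have hcd : ContDiffAt ℝ 1 (stereoToFun (-σ)) σ :=
    contDiffOn_stereoToFun.contDiffAt (hopen.mem_nhds h1)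
  obtain ⟨K, t, ht, hK⟩ := hcd.exists_lipschitzOnWith
  have hpre : φ ⁻¹' (t ∩ U) ∈ nhds (0 : W) :=
    hφ.continuousAt.preimage_mem_nhds (by rw [hφ0]; exact Filter.inter_mem ht hU)
  have hpos : 0 < μH[(d : ℝ)] (φ ⁻¹' (t ∩ U)) := by
    rw [← hW]
    exact Measure.measure_pos_of_mem_nhds _ hpre
  by_contra hz
  have hz : μH[(d : ℝ)] (U ∩ Metric.sphere (0 : E) 1) = 0 := by simpa using hz
  have hle := (hK.mono (inter_subset_left (t := U ∩ Metric.sphere (0 : E) 1))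
    ).hausdorffMeasure_image_le (d := d) d.cast_nonneg
  rw [measure_mono_null inter_subset_right hz, mul_zero] at hle
  refine hpos.not_ge ((measure_mono ?_).trans hle)
  intro w hw
  exact ⟨φ w, ⟨hw.1, hw.2, (stereoInvFun hv w).2⟩, stereo_right_inv hv w⟩

/-- `r cosh r ≥ (1 + r²/4) sinh r` for `0 ≤ r ≤ 7/4`. -/
theorem one_add_sq_div_four_mul_sinh_le {r : ℝ} (h0 : 0 ≤ r) (h1 : r ≤ 7 / 4) :
    (1 + r ^ 2 / 4) * sinh r ≤ r * cosh r := by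
  have htanh : ∀ s : ℝ, 0 ≤ s → s ≤ 7 / 4 → s / 2 * cosh s ≤ sinh s := by
    intro s hs hs'
    have hexp : 1 + 2 * s + (2 * s) ^ 2 / 2 + (2 * s) ^ 3 / 6 ≤ exp (2 * s) := by
      have := sum_le_exp_of_nonneg (x := 2 * s) (by positivity) 4
      simpa [Finset.sum_range_succ, Nat.factorial] using this
    have hpoly : 2 + s ≤ (1 + 2 * s + (2 * s) ^ 2 / 2 + (2 * s) ^ 3 / 6) * (2 - s) := by
      nlinarith [mul_nonneg hs (sub_nonneg.2 hs'), mul_nonneg (mul_nonneg hs hs) (sub_nonneg.2 hs'),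
        mul_nonneg (mul_nonneg (mul_nonneg hs hs) hs) (sub_nonneg.2 hs')]
    have hkey : 2 + s ≤ exp (2 * s) * (2 - s) :=
      hpoly.trans (mul_le_mul_of_nonneg_right hexp (by linarith))
    have he : exp (2 * s) = exp s * exp s := by rw [← exp_add]; ring_nf
    have hinv : exp s * exp (-s) = 1 := by rw [← exp_add]; simp
    rw [cosh_eq, sinh_eq]
    have h3 := mul_le_mul_of_nonneg_right hkey (exp_pos (-s)).le
    rw [he] at h3
    have h4 : exp s * exp s * (2 - s) * exp (-s) = exp s * (2 - s) := by
      linear_combination exp s * (2 - s) * hinv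
    rw [h4] at h3
    linarith
  let G : ℝ → ℝ := fun s => s * cosh s - (1 + s ^ 2 / 4) * sinh s
  have hG : ∀ s, HasDerivAt G (s / 2 * (sinh s - s / 2 * cosh s)) s := by
    intro s
    have h := ((hasDerivAt_id s).mul (hasDerivAt_cosh s)).sub
      (((((hasDerivAt_id s).pow 2).div_const 4).const_add 1).mul (hasDerivAt_sinh s))
    refine h.congr_deriv ?_
    simp
    ring
  have hmono : MonotoneOn G (Icc 0 (7 / 4)) := by
    refine monotoneOn_of_deriv_nonneg (convex_Icc _ _)
      (fun s _ => (hG s).continuousAt.continuousWithinAt)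
      (fun s _ => (hG s).differentiableAt.differentiableWithinAt) fun s hs => ?_
    rw [interior_Icc] at hs
    rw [(hG s).deriv]
    exact mul_nonneg (by linarith [hs.1]) (sub_nonneg.2 (htanh s hs.1.le hs.2.le))
  have := hmono ⟨le_rfl, by norm_num⟩ ⟨h0, h1⟩ h0
  simp only [G] at this
  simp at this
  linarith

/-- The logarithmic derivative of `r^{1-n} sinh^n r` is at least `√n`, for `n = c² ≥ 2`. -/
theorem le_mul_coth_sub {c r : ℝ} (hc : 0 ≤ c) (hc2 : 2 ≤ c ^ 2) (hr : 0 < r) :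
    c ≤ c ^ 2 * (cosh r / sinh r) - (c ^ 2 - 1) / r := by
  have hs : 0 < sinh r := sinh_pos_iff.2 hr
  rcases le_total r (7 / 4) with h | h
  · have h1 := one_add_sq_div_four_mul_sinh_le hr.le h
    have h2 : (1 + r ^ 2 / 4) / r ≤ cosh r / sinh r := by
      rw [div_le_div_iff₀ hr hs]; linarith
    have h3 : c ^ 2 * ((1 + r ^ 2 / 4) / r) - (c ^ 2 - 1) / r - c = (c * r / 2 - 1) ^ 2 / r := by
      field_simp; ring
    have h4 : 0 ≤ (c * r / 2 - 1) ^ 2 / r := by positivity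
    nlinarith [mul_le_mul_of_nonneg_left h2 (sq_nonneg c)]
  · have h2 : 1 ≤ cosh r / sinh r := by
      rw [le_div_iff₀ hs]; linarith [sinh_lt_cosh r]
    have hc43 : 4 / 3 ≤ c := by nlinarith
    have h3 : c ≤ c ^ 2 - (c ^ 2 - 1) / r := by
      rw [le_sub_iff_add_le, ← le_sub_iff_add_le', div_le_iff₀ hr]
      nlinarith [mul_nonneg (mul_nonneg hc (by linarith : 0 ≤ c - 4 / 3)) (sub_nonneg.2 h),
        mul_nonneg hc (sub_nonneg.2 h)]
    nlinarith [mul_le_mul_of_nonneg_left h2 (sq_nonneg c)]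

/-- The radial weight `r^{2-N} sinh^{N-1} r`. -/
def radWeight (N : ℕ) (r : ℝ) : ℝ := r ^ ((2 : ℝ) - N) * sinh r ^ (N - 1)

theorem radWeight_pos (N : ℕ) {r : ℝ} (hr : 0 < r) : 0 < radWeight N r :=
  mul_pos (rpow_pos_of_pos hr _) (pow_pos (sinh_pos_iff.2 hr) _)

theorem hasDerivAt_radWeight {N : ℕ} (hN : 2 ≤ N) {r : ℝ} (hr : 0 < r) :
    HasDerivAt (radWeight N)
      (radWeight N r * (((N : ℝ) - 1) * (cosh r / sinh r) - ((N : ℝ) - 2) / r)) r := by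
  obtain ⟨m, rfl⟩ := Nat.exists_eq_add_of_le hN
  have hs : sinh r ≠ 0 := (sinh_pos_iff.2 hr).ne'
  have h := (hasDerivAt_rpow_const (p := (2 : ℝ) - (2 + m : ℕ)) (Or.inl hr.ne')).mul
    ((hasDerivAt_sinh r).pow (2 + m - 1))
  have e1 : 2 + m - 1 = m + 1 := by omega
  have e2 : r ^ ((2 : ℝ) - (2 + m : ℕ) - 1) = r ^ ((2 : ℝ) - (2 + m : ℕ)) / r := by
    rw [rpow_sub_one hr.ne']
  refine h.congr_deriv ?_
  rw [e2]
  simp only [radWeight, e1, Pi.pow_apply]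
  push_cast
  field_simp
  simp
  ring

theorem continuousOn_radWeight (N : ℕ) : ContinuousOn (radWeight N) (Ioi 0) := by
  refine ContinuousOn.mul (fun r hr => ?_) (continuous_sinh.pow _).continuousOn
  exact (continuousAt_rpow_const _ _ (Or.inl (ne_of_gt hr))).continuousWithinAt

/-- The one-dimensional weighted Poincaré inequality underlying the radial estimate. -/
theorem integral_radWeight_mul_sq_le {N : ℕ} (hN : 3 ≤ N) {f : ℝ → ℝ} (hf : ContDiff ℝ 1 f)
    {a b : ℝ} (ha : 0 < a) (hab : a ≤ b) (hfa : f a = 0) (hfb : f b = 0) :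
    ((N : ℝ) - 1) / 4 * ∫ r in a..b, radWeight N r * f r ^ 2 ≤
      ∫ r in a..b, radWeight N r * deriv f r ^ 2 := by
  have hN' : (3 : ℝ) ≤ N := by exact_mod_cast hN
  set c : ℝ := √((N : ℝ) - 1) with hc
  have hc0 : 0 ≤ c := sqrt_nonneg _
  have hcc : c ^ 2 = (N : ℝ) - 1 := sq_sqrt (by linarith)
  have hpos : ∀ r ∈ Icc a b, 0 < r := fun r hr => ha.trans_le hr.1
  let w' : ℝ → ℝ := fun r =>
    radWeight N r * (((N : ℝ) - 1) * (cosh r / sinh r) - ((N : ℝ) - 2) / r)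
  have hw : ContinuousOn (radWeight N) (Icc a b) :=
    (continuousOn_radWeight N).mono fun r hr => hpos r hr
  have hw' : ContinuousOn w' (Icc a b) := by
    refine hw.mul (ContinuousOn.sub (continuousOn_const.mul
      (continuous_cosh.continuousOn.div continuous_sinh.continuousOn fun r hr => ?_))
      (continuousOn_const.div continuousOn_id fun r hr => (hpos r hr).ne'))
    exact (sinh_pos_iff.2 (hpos r hr)).ne'
  have hf0 : Continuous f := hf.continuous
  have hf1 : Continuous (deriv f) := hf.continuous_deriv le_rfl
  have i0 : IntervalIntegrable (fun r => radWeight N r * f r ^ 2) volume a b :=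
    (hw.mul (hf0.pow 2).continuousOn).intervalIntegrable_of_Icc hab
  have i1 : IntervalIntegrable (fun r => radWeight N r * deriv f r ^ 2) volume a b :=
    (hw.mul (hf1.pow 2).continuousOn).intervalIntegrable_of_Icc hab
  have i2 : IntervalIntegrable
      (fun r => w' r * f r ^ 2 + radWeight N r * (2 * f r * deriv f r)) volume a b :=
    ((hw'.mul (hf0.pow 2).continuousOn).add (hw.mul
      ((continuous_const.mul hf0).mul hf1).continuousOn)).intervalIntegrable_of_Icc hab
  have hFTC : ∫ r in a..b, (w' r * f r ^ 2 + radWeight N r * (2 * f r * deriv f r)) = 0 := by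
    rw [intervalIntegral.integral_eq_sub_of_hasDerivAt (f := fun r => radWeight N r * f r ^ 2)
      (fun r hr => ?_) i2]
    · simp [hfa, hfb]
    · rw [uIcc_of_le hab] at hr
      have h := (hasDerivAt_radWeight (by omega : 2 ≤ N) (hpos r hr)).mul
        (((hf.differentiable one_ne_zero) r).hasDerivAt.pow 2)
      refine h.congr_deriv ?_
      simp [w']
  have hnn : 0 ≤ ∫ r in a..b, (radWeight N r * deriv f r ^ 2 +
      c / 2 * (w' r * f r ^ 2 + radWeight N r * (2 * f r * deriv f r)) -
      ((N : ℝ) - 1) / 4 * (radWeight N r * f r ^ 2)) := by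
    refine intervalIntegral.integral_nonneg hab fun r hr => ?_
    have hM := le_mul_coth_sub hc0 (by linarith) (hpos r hr)
    rw [hcc] at hM
    set M : ℝ := ((N : ℝ) - 1) * (cosh r / sinh r) - ((N : ℝ) - 2) / r with hMdef
    have hM' : c ≤ M := by
      rw [hMdef]; convert hM using 3; ring
    have e : radWeight N r * deriv f r ^ 2 +
        c / 2 * (w' r * f r ^ 2 + radWeight N r * (2 * f r * deriv f r)) -
        ((N : ℝ) - 1) / 4 * (radWeight N r * f r ^ 2) =
        radWeight N r * ((deriv f r + c / 2 * f r) ^ 2 + c / 2 * (M - c) * f r ^ 2) := by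
      have hw'M : w' r = radWeight N r * M := rfl
      rw [hw'M, ← hcc]
      ring
    rw [e]
    have := sub_nonneg.2 hM'
    have := (radWeight_pos N (hpos r hr)).le
    positivity
  rw [intervalIntegral.integral_sub (i1.add (i2.const_mul _)) (i0.const_mul _),
    intervalIntegral.integral_add i1 (i2.const_mul _), intervalIntegral.integral_const_mul,
    intervalIntegral.integral_const_mul, hFTC] at hnn
  linarith

/-- A weighted integral over `ℍ^N` of a function supported in `[a,b] × S^{N-1}` only sees
radii in `[a/2,b+1]`. -/
theorem hypInt_rpow_mul_eq {N : ℕ} {G : ℝ → EuclideanSpace ℝ (Fin N) → ℝ} {a b : ℝ} (ha : 0 < a)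
    (hab : a ≤ b)
    (hG : ∀ r ∉ Icc a b, ∀ σ ∈ Metric.sphere (0 : EuclideanSpace ℝ (Fin N)) 1, G r σ = 0) :
    hypInt N (fun r σ => r ^ ((2 : ℝ) - N) * G r σ) =
      ∫ σ in Metric.sphere (0 : EuclideanSpace ℝ (Fin N)) 1,
        (∫ r in a / 2..b + 1, radWeight N r * G r σ) ∂μH[(N : ℝ) - 1] := by
  refine setIntegral_congr_fun Metric.isClosed_sphere.measurableSet fun σ hσ => ?_
  simp only
  rw [intervalIntegral.integral_of_le (by linarith)]
  rw [setIntegral_eq_of_subset_of_forall_sdiff_eq_zero (s := Ioc (a / 2) (b + 1)) measurableSet_Ioi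
    (fun r hr => (half_pos ha).trans hr.1)]
  · refine setIntegral_congr_fun measurableSet_Ioc fun r _ => ?_
    simp only [radWeight]
    ring
  · rintro r ⟨-, hr⟩
    rw [hG r (fun h => hr ⟨by linarith [h.1], by linarith [h.2]⟩) σ hσ]
    simp

theorem continuous_integral_radWeight_mul {N : ℕ} {X : Type*} [TopologicalSpace X]
    [FirstCountableTopology X] [LocallyCompactSpace X] {G : ℝ → X → ℝ}
    (hG : Continuous (Function.uncurry G)) {a b : ℝ} (ha : 0 < a) (hab : a ≤ b) :
    Continuous fun x => ∫ r in a..b, radWeight N r * G r x := by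
  have hw : Continuous fun r => radWeight N (max r a) :=
    (continuousOn_radWeight N).comp_continuous (by fun_prop) fun r => lt_max_of_lt_right ha
  have h : ∀ x, ∫ r in a..b, radWeight N r * G r x =
      ∫ r in a..b, radWeight N (max r a) * G r x := by
    intro x
    refine intervalIntegral.integral_congr fun r hr => ?_
    rw [uIcc_of_le hab] at hr
    simp only [max_eq_left hr.1]
  simp_rw [h]
  refine intervalIntegral.continuous_parametric_intervalIntegral_of_continuous'
    (f := fun x r => radWeight N (max r a) * G r x) ?_ _ _
  exact (hw.comp continuous_snd).mul (hG.comp continuous_swap)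

theorem integrableOn_sphere_of_continuous {N : ℕ} (hN : 1 ≤ N)
    {g : EuclideanSpace ℝ (Fin N) → ℝ} (hg : Continuous g) :
    IntegrableOn g (Metric.sphere (0 : EuclideanSpace ℝ (Fin N)) 1) μH[(N : ℝ) - 1] := by
  obtain ⟨d, rfl⟩ := Nat.exists_eq_add_of_le' hN
  have : Fact (Module.finrank ℝ (EuclideanSpace ℝ (Fin (d + 1))) = d + 1) := ⟨by simp⟩
  have hfin := hausdorffMeasure_sphere_lt_top_s7 (E := EuclideanSpace ℝ (Fin (d + 1))) (d := d)
  obtain ⟨M, hM⟩ := (isCompact_sphere _ 1).exists_bound_of_continuousOn hg.continuousOn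
  refine Measure.integrableOn_of_bounded (M := M) ?_ hg.aestronglyMeasurable ?_
  · simpa using hfin.ne
  · exact (ae_restrict_iff' Metric.isClosed_sphere.measurableSet).2 (.of_forall hM)

theorem setIntegral_sphere_pos {N : ℕ} (hN : 1 ≤ N) {g : EuclideanSpace ℝ (Fin N) → ℝ}
    (hg : Continuous g) (h0 : ∀ σ, 0 ≤ g σ) {σ : EuclideanSpace ℝ (Fin N)}
    (hσ : σ ∈ Metric.sphere (0 : EuclideanSpace ℝ (Fin N)) 1) (hσg : 0 < g σ) :
    0 < ∫ σ in Metric.sphere (0 : EuclideanSpace ℝ (Fin N)) 1, g σ ∂μH[(N : ℝ) - 1] := by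
  rw [setIntegral_pos_iff_support_of_nonneg_ae (.of_forall h0)
    (integrableOn_sphere_of_continuous hN hg)]
  obtain ⟨d, rfl⟩ := Nat.exists_eq_add_of_le' hN
  have : Fact (Module.finrank ℝ (EuclideanSpace ℝ (Fin (d + 1))) = d + 1) := ⟨by simp⟩
  have h := hausdorffMeasure_inter_sphere_pos (d := d)
    (hg.isOpen_support.mem_nhds (Function.mem_support.2 hσg.ne')) hσ
  simpa using h

theorem continuous_uncurry_radGrad {N : ℕ} {u : ℝ → EuclideanSpace ℝ (Fin N) → ℝ}
    (hu : ContDiff ℝ 1 (Function.uncurry u)) : Continuous (Function.uncurry (radGrad N u)) := by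
  have h : Function.uncurry (radGrad N u) = fun p => fderiv ℝ (Function.uncurry u) p (1, 0) := by
    ext ⟨r, σ⟩
    have h1 := (hu.differentiable one_ne_zero (r, σ)).hasFDerivAt.comp_hasDerivAt r
      ((hasDerivAt_id r).prodMk (hasDerivAt_const r σ))
    exact h1.deriv
  rw [h]
  exact (hu.continuous_fderiv one_ne_zero).clm_apply continuous_const

theorem radGrad_eq_zero {N : ℕ} {u : ℝ → EuclideanSpace ℝ (Fin N) → ℝ} {a b : ℝ}
    {σ : EuclideanSpace ℝ (Fin N)} (hu : ∀ r ∉ Icc a b, u r σ = 0) {r : ℝ} (hr : r ∉ Icc a b) :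
    radGrad N u r σ = 0 := by
  have h : (fun s => u s σ) =ᶠ[nhds r] fun _ => 0 := by
    filter_upwards [isClosed_Icc.isOpen_compl.mem_nhds hr] with s hs using hu s hs
  simp [radGrad, h.deriv_eq]

theorem hypInt_sq_le_hypInt_radGrad_sq {N : ℕ} (hN : 3 ≤ N)
    {u : ℝ → EuclideanSpace ℝ (Fin N) → ℝ} (hu : IsCcAway N u) :
    ((N : ℝ) - 1) / 4 * hypInt N (fun r σ => r ^ ((2 : ℝ) - N) * (u r σ) ^ 2) ≤
      hypInt N (fun r σ => r ^ ((2 : ℝ) - N) * (radGrad N u r σ) ^ 2) := by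
  obtain ⟨hsm, a, b, ha, hab, hz⟩ := hu
  have hsm1 : ContDiff ℝ 1 (Function.uncurry u) := hsm.of_le (by exact_mod_cast le_top)
  have hab' : a / 2 ≤ b + 1 := by linarith
  rw [hypInt_rpow_mul_eq (G := fun r σ => u r σ ^ 2) ha hab
      (fun r hr σ hσ => by simp [hz r hr σ hσ]),
    hypInt_rpow_mul_eq (G := fun r σ => radGrad N u r σ ^ 2) ha hab
      (fun r hr σ hσ => by simp [radGrad_eq_zero (fun r hr => hz r hr σ hσ) hr]),
    ← integral_const_mul]
  refine setIntegral_mono_on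
    ((integrableOn_sphere_of_continuous (by omega) (continuous_integral_radWeight_mul
      (hsm1.continuous.pow 2) (half_pos ha) hab')).const_mul _)
    (integrableOn_sphere_of_continuous (by omega) (continuous_integral_radWeight_mul
      ((continuous_uncurry_radGrad hsm1).pow 2) (half_pos ha) hab'))
    Metric.isClosed_sphere.measurableSet fun σ hσ => ?_
  refine integral_radWeight_mul_sq_le hN (f := fun r => u r σ)
    (hsm1.comp (contDiff_id.prodMk contDiff_const)) (half_pos ha) hab' ?_ ?_
  · exact hz _ (fun h => by linarith [h.1]) σ hσ
  · exact hz _ (fun h => by linarith [h.2]) σ hσ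

theorem hypInt_sq_pos {N : ℕ} (hN : 1 ≤ N) {u : ℝ → EuclideanSpace ℝ (Fin N) → ℝ}
    (hu : IsCcAway N u) {r : ℝ} {σ : EuclideanSpace ℝ (Fin N)}
    (hσ : σ ∈ Metric.sphere (0 : EuclideanSpace ℝ (Fin N)) 1) (hne : u r σ ≠ 0) :
    0 < hypInt N (fun r σ => r ^ ((2 : ℝ) - N) * (u r σ) ^ 2) := by
  obtain ⟨hsm, a, b, ha, hab, hz⟩ := hu
  have hab' : a / 2 < b + 1 := by linarith
  have hpos : ∀ s, a / 2 ≤ s → 0 < radWeight N s := fun s hs =>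
    radWeight_pos N ((half_pos ha).trans_le hs)
  have hr : r ∈ Icc a b := by
    by_contra h
    exact hne (hz r h σ hσ)
  rw [hypInt_rpow_mul_eq (G := fun r σ => u r σ ^ 2) ha hab
      (fun r hr σ hσ => by simp [hz r hr σ hσ])]
  refine setIntegral_sphere_pos hN (continuous_integral_radWeight_mul
      (hsm.continuous.pow 2) (half_pos ha) hab'.le) (fun τ => ?_) hσ ?_
  · exact intervalIntegral.integral_nonneg hab'.le fun s hs =>
      mul_nonneg (hpos s hs.1).le (sq_nonneg _)
  · refine intervalIntegral.integral_pos hab' ?_ (fun s hs =>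
      mul_nonneg (hpos s hs.1.le).le (sq_nonneg _))
      ⟨r, ⟨by linarith [hr.1], by linarith [hr.2]⟩, ?_⟩
    · exact ((continuousOn_radWeight N).mono fun s hs => (half_pos ha).trans_le hs.1).mul
        ((hsm.continuous.comp (continuous_id.prodMk continuous_const)).pow 2).continuousOn
    · exact mul_pos (hpos r (by linarith [hr.1])) (by positivity)

theorem exists_isCcAway_ne_zero {N : ℕ} (hN : 1 ≤ N) :
    ∃ u : ℝ → EuclideanSpace ℝ (Fin N) → ℝ, IsCcAway N u ∧
      ∃ r : ℝ, ∃ σ ∈ Metric.sphere (0 : EuclideanSpace ℝ (Fin N)) 1, 0 < r ∧ u r σ ≠ 0 := by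
  let f : ContDiffBump (2 : ℝ) := ⟨1 / 2, 1, by norm_num, by norm_num⟩
  refine ⟨fun r _ => f r, ⟨f.contDiff.comp contDiff_fst, 1, 3, one_pos, by norm_num,
    fun r hr σ _ => ?_⟩, 2, EuclideanSpace.single ⟨0, hN⟩ 1, by simp, two_pos, ?_⟩
  · refine f.zero_of_le_dist ?_
    rw [Real.dist_eq]
    by_contra! h
    have h' : |r - 2| < 1 := h
    rw [abs_lt] at h'
    exact hr ⟨by linarith, by linarith⟩
  · exact (f.pos_of_mem_ball (Metric.mem_ball_self f.rOut_pos)).ne'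

/-- `∫ r^{2-N} |∇_r u|² dv ≥ ((N-1)/4) ∫ r^{2-N} u² dv` on `ℍ^N`; equivalently the
infimum `μ_r(ℍ^N)` of the corresponding Rayleigh quotient over nonzero
`u ∈ C_c^∞(ℍ^N∖{o})` satisfies `μ_r(ℍ^N) ≥ (N-1)/4`. -/
theorem mu_r_ge (N : ℕ) (hN : 3 ≤ N) :
    (∀ u : ℝ → EuclideanSpace ℝ (Fin N) → ℝ, IsCcAway N u →
      hypInt N (fun r σ => r ^ ((2 : ℝ) - N) * (radGrad N u r σ) ^ 2) ≥
        (((N : ℝ) - 1) / 4) * hypInt N (fun r σ => r ^ ((2 : ℝ) - N) * (u r σ) ^ 2)) ∧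
    (((N : ℝ) - 1) / 4) ≤
      sInf {t : ℝ | ∃ u : ℝ → EuclideanSpace ℝ (Fin N) → ℝ, IsCcAway N u ∧
        (∃ r : ℝ, ∃ σ ∈ Metric.sphere (0 : EuclideanSpace ℝ (Fin N)) 1,
          0 < r ∧ u r σ ≠ 0) ∧
        t = hypInt N (fun r σ => r ^ ((2 : ℝ) - N) * (radGrad N u r σ) ^ 2) /
            hypInt N (fun r σ => r ^ ((2 : ℝ) - N) * (u r σ) ^ 2)} := by
  refine ⟨fun u hu => hypInt_sq_le_hypInt_radGrad_sq hN hu, le_csInf ?_ ?_⟩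
  · obtain ⟨u, hu, hne⟩ := exists_isCcAway_ne_zero (by omega : 1 ≤ N)
    exact ⟨_, u, hu, hne, rfl⟩
  · rintro t ⟨u, hu, ⟨r, σ, hσ, -, hne⟩, rfl⟩
    rw [le_div_iff₀ (hypInt_sq_pos (by omega) hu hσ hne)]
    exact hypInt_sq_le_hypInt_radGrad_sq hN hu
end
end
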